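/- arXiv:2306.10287 — 3 statements merged into one kernel-verified Lean document; each statement's English description precedes it below -/
import Mathlib

section
/- Let X ∈ ℝ^{T×D} be a data matrix, ε > 0, Δ ∈ ℝ^{T×T} the periodic differencing operator, and F^ε(W,P;X) = Σ_{d=1}^D W_d · (X_{:,d})ᵀ Pᵀ Δᵀ Δ P X_{:,d} + ε Σ_{d=1}^D W_d log W_d. If (W*, P*) minimizes F^ε(·,·;X) over the probability simplex 𝒫^D and the set of T×T permutation matrices, and Q ∈ ℝ^{T×T} is any permutation matrix, then (W*, P* Qᵀ) minimizes F^ε(·,·;QX) over the same constraint set, i.e. it is a solution of the problem with the permuted data matrix QX. -/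
open Matrix BigOperators Real Filter

/-- The periodic finite-differencing operator `Δ ∈ ℝ^{T×T}`:
`Δ_{i,i} = -1`, `Δ_{i,i+1 (mod T)} = 1`, all other entries `0`. -/
def pDelta (T : ℕ) : Matrix (Fin T) (Fin T) ℝ :=
  Matrix.of fun i j => if j = i then (-1 : ℝ) else if (j : ℕ) = ((i : ℕ) + 1) % T then 1 else 0

/-- A ('crisp') permutation matrix: entries are all `0` or `1`, with every
row and every column summing to `1`. -/
def IsPermMatrix {T : ℕ} (P : Matrix (Fin T) (Fin T) ℝ) : Prop :=
  (∀ i j, P i j = 0 ∨ P i j = 1) ∧ (∀ i, ∑ j, P i j = 1) ∧ (∀ j, ∑ i, P i j = 1)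

/-- Membership in the probability simplex `𝒫^D`. -/
def InSimplex {D : ℕ} (W : Fin D → ℝ) : Prop :=
  (∀ d, 0 ≤ W d) ∧ ∑ d, W d = 1

/-- The Euclidean non-smoothness `xᵀ Pᵀ Δᵀ Δ P x = ‖Δ P x‖₂²` of the permuted vector `P x`. -/
noncomputable def nonSmooth {T : ℕ} (P : Matrix (Fin T) (Fin T) ℝ) (x : Fin T → ℝ) : ℝ :=
  (pDelta T *ᵥ (P *ᵥ x)) ⬝ᵥ (pDelta T *ᵥ (P *ᵥ x))

/-- The entropy-regularized expected non-smoothness functional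
`F^ε(W,P;X) = Σ_d W_d xᵀ_d Pᵀ Δᵀ Δ P x_d + ε Σ_d W_d log W_d`
(with `x_d = X_{:,d}` the `d`-th column and `0 log 0 = 0`, as `Real.log 0 = 0`). -/
noncomputable def Fobj {T D : ℕ} (ε : ℝ) (W : Fin D → ℝ)
    (P : Matrix (Fin T) (Fin T) ℝ) (X : Matrix (Fin T) (Fin D) ℝ) : ℝ :=
  ∑ d, W d * nonSmooth P (fun t => X t d) + ε * ∑ d, W d * Real.log (W d)

namespace IsPermMatrix

variable {T : ℕ} {P R : Matrix (Fin T) (Fin T) ℝ}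

lemma exists_row_eq_single (hP : IsPermMatrix P) (i : Fin T) :
    ∃ k, P i = Pi.single k 1 := by
  obtain ⟨k, -, hk⟩ : ∃ k ∈ Finset.univ, P i k ≠ 0 :=
    Finset.exists_ne_zero_of_sum_ne_zero (by rw [hP.2.1 i]; exact one_ne_zero)
  have hk1 : P i k = 1 := (hP.1 i k).resolve_left hk
  have hnn : ∀ j, 0 ≤ P i j := fun j => by
    rcases hP.1 i j with h | h <;> simp [h]
  have hrest : ∑ j ∈ Finset.univ.erase k, P i j = 0 := by
    have h := Finset.add_sum_erase Finset.univ (P i) (Finset.mem_univ k)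
    rw [hP.2.1 i, hk1] at h
    linarith
  rw [Finset.sum_eq_zero_iff_of_nonneg fun j _ => hnn j] at hrest
  refine ⟨k, funext fun j => ?_⟩
  by_cases hj : j = k
  · subst hj
    simp [hk1]
  · simp [hj, hrest j]

protected lemma transpose (hP : IsPermMatrix P) : IsPermMatrix Pᵀ :=
  ⟨fun i j => hP.1 j i, hP.2.2, hP.2.1⟩

protected lemma mul (hP : IsPermMatrix P) (hR : IsPermMatrix R) : IsPermMatrix (P * R) := by
  refine ⟨fun i j => ?_, fun i => ?_, fun j => ?_⟩
  · obtain ⟨k, hk⟩ := hP.exists_row_eq_single i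
    rw [Matrix.mul_apply, hk]
    simpa [Pi.single_apply] using hR.1 k j
  · simp only [Matrix.mul_apply]
    rw [Finset.sum_comm]
    simp only [← Finset.mul_sum, hR.2.1, mul_one, hP.2.1]
  · simp only [Matrix.mul_apply]
    rw [Finset.sum_comm]
    simp only [← Finset.sum_mul, hP.2.2, one_mul, hR.2.2]

lemma transpose_mul_self (hP : IsPermMatrix P) : Pᵀ * P = 1 := by
  ext j k
  rw [Matrix.mul_apply, Matrix.one_apply]
  have hrow : ∀ i, Pᵀ j i * P i k = if j = k then P i k else 0 := fun i => by
    obtain ⟨l, hl⟩ := hP.exists_row_eq_single i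
    rw [Matrix.transpose_apply, hl]
    simp only [Pi.single_apply]
    grind
  simp only [hrow]
  split_ifs
  · exact hP.2.2 k
  · simp

end IsPermMatrix

lemma Fobj_mul_right {T D : ℕ} (ε : ℝ) (W : Fin D → ℝ) (P Q : Matrix (Fin T) (Fin T) ℝ)
    (X : Matrix (Fin T) (Fin D) ℝ) : Fobj ε W P (Q * X) = Fobj ε W (P * Q) X := by
  have hcol : ∀ d, (fun t => (Q * X) t d) = Q *ᵥ fun t => X t d := fun _ => rfl
  simp only [Fobj, nonSmooth, hcol, Matrix.mulVec_mulVec]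

/-- if `(W*, P*)` minimizes `F^ε(·,·;X)` over `𝒫^D × (permutation matrices)`
and `Q` is a permutation matrix, then `(W*, P* Qᵀ)` minimizes `F^ε(·,·;QX)`. -/
theorem solution_of_permuted_data {T D : ℕ} (ε : ℝ) (hε : 0 < ε)
    (X : Matrix (Fin T) (Fin D) ℝ) (Wstar : Fin D → ℝ)
    (Pstar Q : Matrix (Fin T) (Fin T) ℝ)
    (hWstar : InSimplex Wstar) (hPstar : IsPermMatrix Pstar) (hQ : IsPermMatrix Q)
    (hmin : ∀ (W : Fin D → ℝ) (P : Matrix (Fin T) (Fin T) ℝ),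
      InSimplex W → IsPermMatrix P → Fobj ε Wstar Pstar X ≤ Fobj ε W P X) :
    IsPermMatrix (Pstar * Qᵀ) ∧
    ∀ (W : Fin D → ℝ) (P : Matrix (Fin T) (Fin T) ℝ),
      InSimplex W → IsPermMatrix P →
        Fobj ε Wstar (Pstar * Qᵀ) (Q * X) ≤ Fobj ε W P (Q * X) := by
  refine ⟨hPstar.mul hQ.transpose, fun W P hW hP => ?_⟩
  rw [Fobj_mul_right, Fobj_mul_right, Matrix.mul_assoc, hQ.transpose_mul_self, Matrix.mul_one]
  exact hmin W (P * Q) hW (hP.mul hQ)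
end

section
/- Let X ∈ ℝ^{T×D}, ε > 0, Δ ∈ ℝ^{T×T} the periodic differencing operator, and F^ε(W,P;X) = Σ_{d=1}^D W_d · (X_{:,d})ᵀ Pᵀ Δᵀ Δ P X_{:,d} + ε Σ_{d=1}^D W_d log W_d. Suppose (W*, P*) minimizes F^ε(·,·;X) over the probability simplex 𝒫^D and the set of T×T permutation matrices, and let Q ∈ ℝ^{T×T} be either a cyclic translation permutation matrix (Q_{i,j} = 1 iff i ≡ j + k (mod T) for some fixed k) or the order-inverting (flipping) permutation matrix (Q_{i,j} = 1 iff j = T+1-i). Then (W*, Q P*) also minimizes F^ε(·,·;X) over the same constraint set. -/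
open Matrix BigOperators Real Filter

theorem IsPermMatrix.submatrix_left {T : ℕ} {P : Matrix (Fin T) (Fin T) ℝ}
    (hP : IsPermMatrix P) (σ : Equiv.Perm (Fin T)) : IsPermMatrix (P.submatrix σ id) :=
  ⟨fun i j => hP.1 (σ i) j, fun i => hP.2.1 (σ i),
    fun j => (Equiv.sum_comp σ fun i => P i j).trans (hP.2.2 j)⟩

theorem pDelta_mulVec_apply {n : ℕ} (y : Fin (n + 2) → ℝ) (i : Fin (n + 2)) :
    (pDelta (n + 2) *ᵥ y) i = y (i + 1) - y i := by
  have hne : i + 1 ≠ i := by simp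
  have hval : ∀ j : Fin (n + 2), (j : ℕ) = ((i : ℕ) + 1) % (n + 2) ↔ j = i + 1 := fun j => by
    rw [Fin.ext_iff, Fin.val_add, Fin.val_one]
  have hentry : ∀ j, pDelta (n + 2) i j * y j =
      (if j = i + 1 then y j else 0) - (if j = i then y j else 0) := fun j => by
    simp only [pDelta, Matrix.of_apply, hval]
    by_cases hi : j = i
    · simp [hi, hne.symm]
    · simp [hi]
  simp [Matrix.mulVec, dotProduct, hentry, Finset.sum_sub_distrib]

/-- The periodic total variation is unchanged by reindexing along a permutation which maps the
cycle `i ↦ i + 1` to itself, preserving or reversing its orientation. -/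
theorem pDelta_dotProduct_comp_perm {n : ℕ} (σ : Equiv.Perm (Fin (n + 1)))
    (hσ : (∀ i, σ (i + 1) = σ i + 1) ∨ ∀ i, σ i = σ (i + 1) + 1) (y : Fin (n + 1) → ℝ) :
    (pDelta (n + 1) *ᵥ (y ∘ σ)) ⬝ᵥ (pDelta (n + 1) *ᵥ (y ∘ σ)) =
      (pDelta (n + 1) *ᵥ y) ⬝ᵥ (pDelta (n + 1) *ᵥ y) := by
  cases n with
  | zero => rw [Subsingleton.elim (α := Equiv.Perm (Fin 1)) σ 1, Equiv.Perm.coe_one, Function.comp_id]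
  | succ n =>
    simp only [dotProduct, pDelta_mulVec_apply, Function.comp_apply]
    rcases hσ with h | h
    · simp only [h]
      exact Equiv.sum_comp σ fun i => (y (i + 1) - y i) * (y (i + 1) - y i)
    · rw [← Equiv.sum_comp ((Equiv.addRight 1).trans σ)
        fun i => (y (i + 1) - y i) * (y (i + 1) - y i)]
      refine Finset.sum_congr rfl fun i _ => ?_
      simp only [Equiv.trans_apply, Equiv.coe_addRight, ← h]
      ring

/-- A cyclic translation or flip matrix permutes rows by a symmetry of the cycle. -/
theorem exists_perm_of_translation_or_flip {n : ℕ} {Q : Matrix (Fin (n + 1)) (Fin (n + 1)) ℝ}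
    (hQ : (∃ k : Fin (n + 1), ∀ i j : Fin (n + 1),
            Q i j = if (i : ℕ) = ((j : ℕ) + (k : ℕ)) % (n + 1) then 1 else 0) ∨
          (∀ i j : Fin (n + 1), Q i j = if j = Fin.rev i then 1 else 0)) :
    ∃ σ : Equiv.Perm (Fin (n + 1)), (∀ i j, Q i j = if j = σ i then 1 else 0) ∧
      ((∀ i, σ (i + 1) = σ i + 1) ∨ ∀ i, σ i = σ (i + 1) + 1) := by
  rcases hQ with ⟨k, hk⟩ | hrev
  · refine ⟨Equiv.subRight k, fun i j => ?_, Or.inl fun i => ?_⟩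
    · rw [hk]
      refine if_congr ?_ rfl rfl
      rw [← Fin.val_add, ← Fin.ext_iff, Equiv.subRight_apply, eq_sub_iff_add_eq, eq_comm]
    · simp only [Equiv.subRight_apply]
      exact add_sub_right_comm i 1 k
  · refine ⟨Fin.revPerm, hrev, Or.inr fun i => ?_⟩
    simp only [Fin.revPerm_apply, ← Fin.last_sub]
    abel

theorem mul_eq_submatrix_of_apply_eq_ite {T : ℕ} {Q : Matrix (Fin T) (Fin T) ℝ}
    {σ : Equiv.Perm (Fin T)} (hQ : ∀ i j, Q i j = if j = σ i then 1 else 0)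
    (P : Matrix (Fin T) (Fin T) ℝ) : Q * P = P.submatrix σ id := by
  ext i j
  simp [Matrix.mul_apply, hQ]

/-- if `(W*, P*)` minimizes `F^ε(·,·;X)` and `Q` is a cyclic translation
or the order-inverting (flipping) permutation matrix, then `(W*, Q P*)` also
minimizes `F^ε(·,·;X)`. -/
theorem translated_or_flipped_solution {T D : ℕ} (ε : ℝ) (hε : 0 < ε)
    (X : Matrix (Fin T) (Fin D) ℝ) (Wstar : Fin D → ℝ)
    (Pstar Q : Matrix (Fin T) (Fin T) ℝ)
    (hWstar : InSimplex Wstar) (hPstar : IsPermMatrix Pstar)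
    (hQ : (∃ k : Fin T, ∀ i j : Fin T,
            Q i j = if (i : ℕ) = ((j : ℕ) + (k : ℕ)) % T then 1 else 0) ∨
          (∀ i j : Fin T, Q i j = if j = Fin.rev i then 1 else 0))
    (hmin : ∀ (W : Fin D → ℝ) (P : Matrix (Fin T) (Fin T) ℝ),
      InSimplex W → IsPermMatrix P → Fobj ε Wstar Pstar X ≤ Fobj ε W P X) :
    IsPermMatrix (Q * Pstar) ∧
    ∀ (W : Fin D → ℝ) (P : Matrix (Fin T) (Fin T) ℝ),
      InSimplex W → IsPermMatrix P →
        Fobj ε Wstar (Q * Pstar) X ≤ Fobj ε W P X := by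
  cases T with
  | zero =>
    rw [Subsingleton.elim (Q * Pstar) Pstar]
    exact ⟨hPstar, hmin⟩
  | succ n =>
    obtain ⟨σ, hQσ, hσ⟩ := exists_perm_of_translation_or_flip hQ
    rw [mul_eq_submatrix_of_apply_eq_ite hQσ]
    have hns : ∀ x, nonSmooth (Pstar.submatrix σ id) x = nonSmooth Pstar x := fun x =>
      pDelta_dotProduct_comp_perm σ hσ (Pstar *ᵥ x)
    refine ⟨hPstar.submatrix_left σ, fun W P hW hP => ?_⟩
    simpa only [Fobj, hns] using hmin W P hW hP
end

section
/- Let X ∈ ℝ^{T×D}, ε > 0, Δ the periodic differencing operator, and F^ε(W,P;X) = Σ_{d=1}^D W_d (X_{:,d})ᵀ Pᵀ Δᵀ Δ P X_{:,d} + ε Σ_{d=1}^D W_d log W_d. Suppose one iteration of the alternating algorithm is applied to a feasible pair (W, P) ∈ 𝒫^D × (permutation matrices): first P' = π_{i*,j*} P where (i*,j*) minimizes the expected non-smoothness Σ_d W_d (X_{:,d})ᵀ (π_{i,j}P)ᵀ Δᵀ Δ (π_{i,j}P) X_{:,d} over all pairs (i,j); then W'_d = exp(-ε⁻¹ (X_{:,d})ᵀ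 (P')ᵀ Δᵀ Δ P' X_{:,d}) / Σ_{j=1}^D exp(-ε⁻¹ (X_{:,j})ᵀ (P')ᵀ Δᵀ Δ P' X_{:,j}). Then F^ε(W', P'; X) ≤ F^ε(W, P; X), i.e. the algorithm monotonically decreases the objective. -/
open Matrix BigOperators Real Filter

/-- The permutation matrix of the transposition interchanging coordinates `i` and `j`
(`π_{i,i}` is the identity matrix). -/
def transpoM {T : ℕ} (i j : Fin T) : Matrix (Fin T) (Fin T) ℝ :=
  Matrix.of fun a b => if b = Equiv.swap i j a then (1 : ℝ) else 0

/-- The pointwise form of the nonnegativity of the Kullback-Leibler divergence. -/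
theorem sub_le_mul_log_sub_mul_log {w q : ℝ} (hw : 0 ≤ w) (hq : 0 < q) :
    w - q ≤ w * Real.log w - w * Real.log q := by
  rcases hw.eq_or_lt with rfl | hw
  · simpa using hq.le
  · have h := mul_le_mul_of_nonneg_left (Real.log_le_sub_one_of_pos (div_pos hq hw)) hw.le
    rw [Real.log_div hq.ne' hw.ne', mul_sub, mul_sub, mul_div_cancel₀ _ hw.ne'] at h
    linarith

/-- The Gibbs weights minimize the entropy-regularized linear functional on the simplex. -/
theorem gibbs_le_of_inSimplex {D : ℕ} {ε : ℝ} (hε : 0 < ε) (c : Fin D → ℝ) {W : Fin D → ℝ}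
    (hW : InSimplex W) :
    ∑ d, Real.exp (-ε⁻¹ * c d) / (∑ j, Real.exp (-ε⁻¹ * c j)) * c d +
        ε * ∑ d, Real.exp (-ε⁻¹ * c d) / (∑ j, Real.exp (-ε⁻¹ * c j)) *
          Real.log (Real.exp (-ε⁻¹ * c d) / (∑ j, Real.exp (-ε⁻¹ * c j))) ≤
      ∑ d, W d * c d + ε * ∑ d, W d * Real.log (W d) := by
  obtain ⟨hW0, hW1⟩ := hW
  have hne : (Finset.univ : Finset (Fin D)).Nonempty :=
    Finset.nonempty_of_sum_ne_zero (hW1.trans_ne one_ne_zero)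
  set Z := ∑ j, Real.exp (-ε⁻¹ * c j) with hZ
  have hZpos : 0 < Z := Finset.sum_pos (fun j _ => Real.exp_pos _) hne
  have hlog (d : Fin D) : Real.log (Real.exp (-ε⁻¹ * c d) / Z) = -ε⁻¹ * c d - Real.log Z := by
    rw [Real.log_div (Real.exp_pos _).ne' hZpos.ne', Real.log_exp]
  have hQ1 : ∑ d, Real.exp (-ε⁻¹ * c d) / Z = 1 := by
    rw [← Finset.sum_div, ← hZ, div_self hZpos.ne']
  have hlhs : ∑ d, Real.exp (-ε⁻¹ * c d) / Z * c d +
      ε * ∑ d, Real.exp (-ε⁻¹ * c d) / Z * Real.log (Real.exp (-ε⁻¹ * c d) / Z) =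
      -(ε * Real.log Z) := by
    calc
      _ = ∑ d, Real.exp (-ε⁻¹ * c d) / Z * -(ε * Real.log Z) := by
        rw [Finset.mul_sum, ← Finset.sum_add_distrib]
        refine Finset.sum_congr rfl fun d _ => ?_
        rw [hlog]
        field_simp
        ring
      _ = _ := by rw [← Finset.sum_mul, hQ1, one_mul]
  have hkl : ∑ d, ε * (W d - Real.exp (-ε⁻¹ * c d) / Z) ≤
      ∑ d, (W d * c d + ε * (W d * Real.log (W d)) + W d * (ε * Real.log Z)) := by
    refine Finset.sum_le_sum fun d _ => ?_
    have h := mul_le_mul_of_nonneg_left (sub_le_mul_log_sub_mul_log (hW0 d)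
      (div_pos (Real.exp_pos (-ε⁻¹ * c d)) hZpos)) hε.le
    rw [hlog] at h
    refine h.trans_eq ?_
    field_simp
    ring
  rw [← Finset.mul_sum, Finset.sum_sub_distrib, hW1, hQ1, Finset.sum_add_distrib,
    Finset.sum_add_distrib, ← Finset.mul_sum, ← Finset.sum_mul, hW1] at hkl
  linarith

theorem transpoM_self {T : ℕ} (i : Fin T) : transpoM i i = 1 := by
  ext a b
  simp [transpoM, Matrix.one_apply, eq_comm]

/-- one full iteration of the alternating algorithm — a `P`-step
`P' = π_{i*,j*} P` (optimal pairwise permutation) followed by a `W`-step with the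
closed-form Gibbs solution — monotonically decreases the objective:
`F^ε(W', P'; X) ≤ F^ε(W, P; X)`. -/
theorem algorithm_iteration_monotone {T D : ℕ} (ε : ℝ) (hε : 0 < ε)
    (X : Matrix (Fin T) (Fin D) ℝ) (W : Fin D → ℝ) (hW : InSimplex W)
    (P : Matrix (Fin T) (Fin T) ℝ) (hP : IsPermMatrix P) (istar jstar : Fin T)
    (hmin : ∀ i j : Fin T,
      ∑ d, W d * nonSmooth (transpoM istar jstar * P) (fun t => X t d) ≤
      ∑ d, W d * nonSmooth (transpoM i j * P) (fun t => X t d)) :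
    Fobj ε
      (fun d => Real.exp (-ε⁻¹ * nonSmooth (transpoM istar jstar * P) (fun t => X t d)) /
        ∑ j, Real.exp (-ε⁻¹ * nonSmooth (transpoM istar jstar * P) (fun t => X t j)))
      (transpoM istar jstar * P) X ≤ Fobj ε W P X := by
  have hstep := hmin istar istar
  rw [transpoM_self, Matrix.one_mul] at hstep
  exact (gibbs_le_of_inSimplex hε _ hW).trans (add_le_add_left hstep _)
end
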